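/- Let s be a chain of elementary moves that starts and ends at the same rectangular diagram of a link R. If s includes a stabilization of oriented type t performed on the connected component number i, then s also includes a destabilization of oriented type t performed on the connected component number i. -/

import Mathlib

open scoped Real

noncomputable section

namespace RectDiag

instance : DecidableEq Real.Angle := Classical.decEq _

/-- The torus `T² = S¹ × S¹` with angular coordinates `(θ, φ)`. -/
abbrev Torus := Real.Angle × Real.Angle

/-- The length of the arc running from `x` to `y` in the positive direction. -/
def arcLen (x y : Real.Angle) : ℝ :=
  if (y - x).toReal < 0 then (y - x).toReal + 2 * Real.pi else (y - x).toReal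

/-- The closed arc `[x;y]` running from `x` to `y` in the positive direction. -/
def Arc (x y : Real.Angle) : Set Real.Angle :=
  {z | ∃ t : ℝ, 0 ≤ t ∧ t ≤ arcLen x y ∧ z = x + (t : Real.Angle)}

/-- The open arc `(x;y)`, the interior of `[x;y]`. -/
def ArcInt (x y : Real.Angle) : Set Real.Angle :=
  {z | ∃ t : ℝ, 0 < t ∧ t < arcLen x y ∧ z = x + (t : Real.Angle)}

/-- Every meridian `{θ}×S¹` contains no or exactly two points of `V`, of opposite signs. -/
def MeridianOK (V : Finset Torus) (sgn : Torus → Bool) : Prop :=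
  ∀ θ : Real.Angle, (∀ v ∈ V, v.1 ≠ θ) ∨
    ∃ u w, u ∈ V ∧ w ∈ V ∧ u ≠ w ∧ u.1 = θ ∧ w.1 = θ ∧ sgn u ≠ sgn w ∧
      ∀ x ∈ V, x.1 = θ → x = u ∨ x = w

/-- Every longitude `S¹×{φ}` contains no or exactly two points of `V`, of opposite signs. -/
def LongitudeOK (V : Finset Torus) (sgn : Torus → Bool) : Prop :=
  ∀ φ : Real.Angle, (∀ v ∈ V, v.2 ≠ φ) ∨
    ∃ u w, u ∈ V ∧ w ∈ V ∧ u ≠ w ∧ u.2 = φ ∧ w.2 = φ ∧ sgn u ≠ sgn w ∧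
      ∀ x ∈ V, x.2 = φ → x = u ∨ x = w

/-- `V` with sign assignment `sgn` satisfies the conditions of a rectangular diagram. -/
def IsDiagSet (V : Finset Torus) (sgn : Torus → Bool) : Prop :=
  MeridianOK V sgn ∧ LongitudeOK V sgn

/-- `S` is a connected component of `V`: a minimal nonempty subset of `V` that is itself a
rectangular diagram of a link (with the inherited signs). -/
def IsComponent (V : Finset Torus) (sgn : Torus → Bool) (S : Finset Torus) : Prop :=
  S ⊆ V ∧ S.Nonempty ∧ IsDiagSet S sgn ∧
    ∀ S' ⊆ S, S'.Nonempty → IsDiagSet S' sgn → S' = S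

/-- An oriented rectangular diagram of a link with numbered connected components:
a finite subset of the torus with a sign assignment satisfying the meridian/longitude
conditions, together with a numbering of the vertices which is constant exactly on
connected components. -/
structure RectDiagram where
  verts : Finset Torus
  sgn : Torus → Bool
  comp : Torus → ℕ
  diag : IsDiagSet verts sgn
  comp_eq_iff : ∀ u ∈ verts, ∀ v ∈ verts,
    (comp u = comp v ↔ ∃ S, IsComponent verts sgn S ∧ u ∈ S ∧ v ∈ S)

/-- `{u,v}` is a (vertical or horizontal) edge of the diagram `R`. -/
def IsEdge (R : RectDiagram) (u v : Torus) : Prop :=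
  u ∈ R.verts ∧ v ∈ R.verts ∧ u ≠ v ∧ (u.1 = v.1 ∨ u.2 = v.2)

/-- The four corner points `{θ₁,θ₂}×{φ₁,φ₂}`. -/
def corners (t1 t2 p1 p2 : Real.Angle) : Finset Torus :=
  {(t1, p1), (t1, p2), (t2, p1), (t2, p2)}

/-- The rectangle `[θ₁;θ₂]×[φ₁;φ₂] ⊆ T²`. -/
def RectSet (t1 t2 p1 p2 : Real.Angle) : Set Torus :=
  {p | p.1 ∈ Arc t1 t2 ∧ p.2 ∈ Arc p1 p2}

/-- `R₁ ↦ R₂` is an elementary move associated with the rectangle `[θ₁;θ₂]×[φ₁;φ₂]`. -/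
def IsElemMoveWith (R₁ R₂ : RectDiagram) (t1 t2 p1 p2 : Real.Angle) : Prop :=
  t1 ≠ t2 ∧ p1 ≠ p2 ∧
  symmDiff R₁.verts R₂.verts = corners t1 t2 p1 p2 ∧
  (∃ u v : Torus, u ∈ symmDiff R₁.verts R₂.verts ∧ v ∈ symmDiff R₁.verts R₂.verts ∧
      (IsEdge R₁ u v ∨ IsEdge R₂ u v)) ∧
  ¬ R₁.verts ⊆ R₂.verts ∧ ¬ R₂.verts ⊆ R₁.verts ∧
  RectSet t1 t2 p1 p2 ∩ (↑R₁.verts ∪ ↑R₂.verts) = ↑(corners t1 t2 p1 p2) ∧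
  ∀ v ∈ R₁.verts ∩ R₂.verts, R₁.sgn v = R₂.sgn v ∧ R₁.comp v = R₂.comp v

/-- `R₁ ↦ R₂` is an elementary move. -/
def IsElemMove (R₁ R₂ : RectDiagram) : Prop :=
  ∃ t1 t2 p1 p2 : Real.Angle, IsElemMoveWith R₁ R₂ t1 t2 p1 p2

/-- An exchange move. -/
def IsExchange (R₁ R₂ : RectDiagram) : Prop :=
  IsElemMove R₁ R₂ ∧ R₂.verts.card = R₁.verts.card

/-- A stabilization. -/
def IsStab (R₁ R₂ : RectDiagram) : Prop :=
  IsElemMove R₁ R₂ ∧ R₂.verts.card = R₁.verts.card + 2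

/-- A destabilization. -/
def IsDestab (R₁ R₂ : RectDiagram) : Prop :=
  IsElemMove R₁ R₂ ∧ R₁.verts.card = R₂.verts.card + 2

/-- A stabilization associated with a given rectangle. -/
def IsStabWith (R₁ R₂ : RectDiagram) (t1 t2 p1 p2 : Real.Angle) : Prop :=
  IsElemMoveWith R₁ R₂ t1 t2 p1 p2 ∧ R₂.verts.card = R₁.verts.card + 2

/-- The type I corner condition: `R₁ ∩ V ⊆ {(θ₁,φ₁),(θ₂,φ₂)}`. -/
def TypeICornerCond (R₁ : RectDiagram) (t1 t2 p1 p2 : Real.Angle) : Prop :=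
  ∀ v ∈ R₁.verts, v ∈ corners t1 t2 p1 p2 → v = (t1, p1) ∨ v = (t2, p2)

/-- The type II corner condition: `R₁ ∩ V ⊆ {(θ₁,φ₂),(θ₂,φ₁)}`. -/
def TypeIICornerCond (R₁ : RectDiagram) (t1 t2 p1 p2 : Real.Angle) : Prop :=
  ∀ v ∈ R₁.verts, v ∈ corners t1 t2 p1 p2 → v = (t1, p2) ∨ v = (t2, p1)

/-- `R₁ ↦ R₂` is a type I stabilization. -/
def IsTypeIStab (R₁ R₂ : RectDiagram) : Prop :=
  ∃ t1 t2 p1 p2, IsStabWith R₁ R₂ t1 t2 p1 p2 ∧ TypeICornerCond R₁ t1 t2 p1 p2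

/-- `R₁ ↦ R₂` is a type II stabilization. -/
def IsTypeIIStab (R₁ R₂ : RectDiagram) : Prop :=
  ∃ t1 t2 p1 p2, IsStabWith R₁ R₂ t1 t2 p1 p2 ∧ TypeIICornerCond R₁ t1 t2 p1 p2

/-- `R₁ ↦ R₂` is a type I destabilization. -/
def IsTypeIDestab (R₁ R₂ : RectDiagram) : Prop := IsTypeIStab R₂ R₁

/-- `R₁ ↦ R₂` is a type II destabilization. -/
def IsTypeIIDestab (R₁ R₂ : RectDiagram) : Prop := IsTypeIIStab R₂ R₁

/-- The four oriented types `→I`, `←I`, `→II`, `←II` of (de)stabilizations. -/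
inductive OType
  | posI
  | negI
  | posII
  | negII
deriving DecidableEq

/-- Whether an oriented type is of (unoriented) type I. -/
def OType.isI : OType → Bool
  | .posI => true
  | .negI => true
  | _ => false

/-- `R₁ ↦ R₂` is a stabilization of the given oriented type. -/
def IsStabOfOType (R₁ R₂ : RectDiagram) (t : OType) : Prop :=
  ∃ t1 t2 p1 p2, IsStabWith R₁ R₂ t1 t2 p1 p2 ∧
    ∃ p0, (p0 = p1 ∨ p0 = p2) ∧ (t1, p0) ∈ R₂.verts ∧ (t2, p0) ∈ R₂.verts ∧
      (match t with
        | .posI => TypeICornerCond R₁ t1 t2 p1 p2 ∧ R₂.sgn (t2, p0) = true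
        | .negI => TypeICornerCond R₁ t1 t2 p1 p2 ∧ R₂.sgn (t2, p0) = false
        | .posII => TypeIICornerCond R₁ t1 t2 p1 p2 ∧ R₂.sgn (t2, p0) = true
        | .negII => TypeIICornerCond R₁ t1 t2 p1 p2 ∧ R₂.sgn (t2, p0) = false)

/-- `R₁ ↦ R₂` is a destabilization of the given oriented type. -/
def IsDestabOfOType (R₁ R₂ : RectDiagram) (t : OType) : Prop := IsStabOfOType R₂ R₁ t

/-- The move `R₁ ↦ R₂` is performed on (modifies) the connected component number `i`. -/
def ModifiesComp (R₁ R₂ : RectDiagram) (i : ℕ) : Prop :=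
  ∃ v ∈ R₁.verts, v ∉ R₂.verts ∧ R₁.comp v = i

/-- The kind of an elementary move: an exchange, a stabilization of oriented type `t`
on the component number `i`, or a destabilization of oriented type `t` on the component
number `i`. -/
inductive MoveKind
  | exchange
  | stab (t : OType) (i : ℕ)
  | destab (t : OType) (i : ℕ)
deriving DecidableEq

/-- The pair `(R₁, R₂)` is an elementary move realizing the given kind. -/
def KindOk (R₁ R₂ : RectDiagram) : MoveKind → Prop
  | .exchange => IsExchange R₁ R₂
  | .stab t i => IsStabOfOType R₁ R₂ t ∧ ModifiesComp R₁ R₂ i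
  | .destab t i => IsDestabOfOType R₁ R₂ t ∧ ModifiesComp R₁ R₂ i

/-- `LChain R s R'` : `s` is a chain of elementary moves from `R` to `R'`, each move
labeled by its kind. -/
def LChain : RectDiagram → List (MoveKind × RectDiagram) → RectDiagram → Prop
  | R, [], R' => R = R'
  | R, (k, S) :: rest, R' => KindOk R S k ∧ LChain S rest R'


/-! ### Arc lengths and the circular order seen from a base point -/

lemma arcLen_nonneg (x y : Real.Angle) : 0 ≤ arcLen x y := by
  unfold arcLen
  have h1 := Real.Angle.neg_pi_lt_toReal (y - x)
  split_ifs <;> linarith [Real.pi_pos]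

lemma arcLen_lt_two_pi (x y : Real.Angle) : arcLen x y < 2 * Real.pi := by
  unfold arcLen
  have h1 := Real.Angle.toReal_le_pi (y - x)
  split_ifs <;> linarith [Real.pi_pos]

lemma add_arcLen (x y : Real.Angle) : x + (arcLen x y : Real.Angle) = y := by
  unfold arcLen
  split_ifs <;> simp

lemma arcLen_self (x : Real.Angle) : arcLen x x = 0 := by
  simp [arcLen]

lemma arcLen_injective (b : Real.Angle) : Function.Injective (arcLen b) := by
  intro x y h
  rw [← add_arcLen b x, ← add_arcLen b y, h]

lemma arcLen_eq_of_add_eq {b x : Real.Angle} {r : ℝ} (h0 : 0 ≤ r) (h1 : r < 2 * Real.pi)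
    (h : b + (r : Real.Angle) = x) : arcLen b x = r := by
  have h2 : ((arcLen b x : ℝ) : Real.Angle) = (r : Real.Angle) := by
    have := (add_arcLen b x).trans h.symm
    exact add_left_cancel this
  obtain ⟨k, hk⟩ := Real.Angle.angle_eq_iff_two_pi_dvd_sub.1 h2
  have h3 := arcLen_nonneg b x
  have h4 := arcLen_lt_two_pi b x
  have hp := Real.pi_pos
  have hk1 : (k : ℝ) < 1 := by nlinarith
  have hk2 : (-1 : ℝ) < k := by nlinarith
  have hk3 : k < 1 := by exact_mod_cast hk1
  have hk4 : -1 < k := by exact_mod_cast hk2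
  have hk5 : k = 0 := by omega
  rw [hk5] at hk
  simp at hk
  linarith

lemma arcLen_change_base (b b' x : Real.Angle) :
    arcLen b' x = arcLen b x - arcLen b b'
      + (if arcLen b x < arcLen b b' then 2 * Real.pi else 0) := by
  have h1 := arcLen_nonneg b x
  have h2 := arcLen_lt_two_pi b x
  have h3 := arcLen_nonneg b b'
  have h4 := arcLen_lt_two_pi b b'
  have h5 : b' + ((arcLen b x : Real.Angle) - (arcLen b b' : Real.Angle)) = x := by
    calc b' + ((arcLen b x : Real.Angle) - (arcLen b b' : Real.Angle))
        = b + (arcLen b b' : Real.Angle)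
          + ((arcLen b x : Real.Angle) - (arcLen b b' : Real.Angle)) := by rw [add_arcLen]
      _ = b + (arcLen b x : Real.Angle) := by abel
      _ = x := add_arcLen b x
  apply arcLen_eq_of_add_eq
  · split_ifs <;> linarith
  · split_ifs <;> linarith
  · split_ifs <;> simp [h5]

lemma mem_Arc_of_arcLen_le {x y z : Real.Angle} (h : arcLen x z ≤ arcLen x y) : z ∈ Arc x y :=
  ⟨arcLen x z, arcLen_nonneg x z, h, (add_arcLen x z).symm⟩

/-- The sign (`1`, `0` or `-1`) of the comparison of `x` with `y` in the linear order obtained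
by cutting the circle at `b`; it is `1` if `x` precedes `y`. -/
def cyc (b x y : Real.Angle) : ℤ :=
  if arcLen b x < arcLen b y then 1 else if arcLen b y < arcLen b x then -1 else 0

lemma cyc_swap (b x y : Real.Angle) : cyc b y x = -cyc b x y := by
  unfold cyc
  split_ifs <;> first | rfl | (exfalso; linarith)

lemma cyc_self (b x : Real.Angle) : cyc b x x = 0 := by simp [cyc]

lemma cyc_base_left {b x : Real.Angle} (h : x ≠ b) : cyc b x b = -1 := by
  have h1 : arcLen b x ≠ 0 := fun h' => h (arcLen_injective b (h'.trans (arcLen_self b).symm))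
  have h2 := lt_of_le_of_ne (arcLen_nonneg b x) h1.symm
  unfold cyc
  rw [arcLen_self, if_neg (not_lt.2 h2.le), if_pos h2]

/-- Changing the point at which the circle is cut modifies `cyc` by a coboundary. -/
lemma cyc_change_base (b b' : Real.Angle) :
    ∃ k : Real.Angle → ℤ, ∀ x y, cyc b' x y = cyc b x y + (k x - k y) := by
  refine ⟨fun x => if arcLen b x < arcLen b b' then -2 else 0, fun x y => ?_⟩
  have h1 := arcLen_nonneg b x
  have h2 := arcLen_lt_two_pi b x
  have h3 := arcLen_nonneg b y
  have h4 := arcLen_lt_two_pi b y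
  unfold cyc
  rw [arcLen_change_base b b' x, arcLen_change_base b b' y]
  beta_reduce
  split_ifs <;> first | (exfalso; linarith) | norm_num

/-- The difference of `cyc` at the two ends of the arc `[p;q]`, as seen from `p`. -/
lemma cyc_sub_eq_zero {p q x : Real.Angle} (h : x ∉ Arc p q) : cyc p p x - cyc p q x = 0 := by
  have h1 : arcLen p q < arcLen p x := lt_of_not_ge fun h' => h (mem_Arc_of_arcLen_le h')
  have h2 : arcLen p p < arcLen p x := by
    rw [arcLen_self]; exact (arcLen_nonneg p q).trans_lt h1
  unfold cyc
  rw [if_pos h1, if_pos h2, sub_self]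

lemma cyc_sub_left {p q : Real.Angle} (h : p ≠ q) : cyc p p p - cyc p q p = 1 := by
  rw [cyc_self, cyc_base_left h.symm]; rfl

lemma cyc_sub_right {p q : Real.Angle} (h : p ≠ q) : cyc p p q - cyc p q q = 1 := by
  rw [cyc_self, cyc_swap, cyc_base_left h.symm]; rfl

/-! ### Signed weights and the sums attached to them -/

/-- The sum of `D u * D v` over all pairs, weighted by the relative position of `u` and `v`
in the square obtained by cutting the torus along `{b} × S¹` and `S¹ × {c}`. -/
def writheSum (T : Finset Torus) (D : Torus → ℤ) (b c : Real.Angle) : ℤ :=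
  ∑ u ∈ T, ∑ v ∈ T, D u * D v * (cyc b u.1 v.1 * cyc c u.2 v.2)

/-- Twice the number of edges (contained in the fibres of `f`) directed upwards minus twice the
number of those directed downwards, where the coordinate `g` along the edges is cut at `b`. -/
def edgeSum (T : Finset Torus) (D : Torus → ℤ) (f g : Torus → Real.Angle) (b : Real.Angle) : ℤ :=
  ∑ u ∈ T, ∑ v ∈ T, D u * (D v ^ 2 * if f u = f v then cyc b (g u) (g v) else 0)

/-- The weights `D` cancel along the fibres of `f`, and each fibre meeting the support of `D`
contains exactly two points of it. -/
structure Balanced (T : Finset Torus) (D : Torus → ℤ) (f : Torus → Real.Angle) : Prop where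
  sum_mul_eq_zero : ∀ k : Real.Angle → ℤ, ∑ u ∈ T, D u * k (f u) = 0
  mul_sum_fiber : ∀ u ∈ T, D u * ∑ v ∈ T, (if f u = f v then D v ^ 2 else 0) = 2 * D u

lemma writheSum_change_fst {T : Finset Torus} {D : Torus → ℤ} (h : Balanced T D Prod.snd)
    (b b' c : Real.Angle) : writheSum T D b' c = writheSum T D b c := by
  obtain ⟨k, hk⟩ := cyc_change_base b b'
  have e1 : ∑ u ∈ T, ∑ v ∈ T, D u * D v * (k u.1 * cyc c u.2 v.2) = 0 := by
    refine Finset.sum_eq_zero fun u _ => ?_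
    rw [← mul_zero (D u * k u.1), ← h.sum_mul_eq_zero fun y => cyc c u.2 y, Finset.mul_sum]
    exact Finset.sum_congr rfl fun v _ => by ring
  have e2 : ∑ u ∈ T, ∑ v ∈ T, D u * D v * (k v.1 * cyc c u.2 v.2) = 0 := by
    rw [Finset.sum_comm]
    refine Finset.sum_eq_zero fun v _ => ?_
    rw [← mul_zero (D v * k v.1), ← h.sum_mul_eq_zero fun y => cyc c y v.2, Finset.mul_sum]
    exact Finset.sum_congr rfl fun u _ => by ring
  have e3 : writheSum T D b' c = writheSum T D b c
      + ∑ u ∈ T, ∑ v ∈ T, D u * D v * (k u.1 * cyc c u.2 v.2)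
      - ∑ u ∈ T, ∑ v ∈ T, D u * D v * (k v.1 * cyc c u.2 v.2) := by
    simp only [writheSum, ← Finset.sum_add_distrib, ← Finset.sum_sub_distrib, hk]
    refine Finset.sum_congr rfl fun u _ => Finset.sum_congr rfl fun v _ => by ring
  rw [e3, e1, e2]; ring

lemma writheSum_change_snd {T : Finset Torus} {D : Torus → ℤ} (h : Balanced T D Prod.fst)
    (b c c' : Real.Angle) : writheSum T D b c' = writheSum T D b c := by
  obtain ⟨k, hk⟩ := cyc_change_base c c'
  have e1 : ∑ u ∈ T, ∑ v ∈ T, D u * D v * (cyc b u.1 v.1 * k u.2) = 0 := by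
    refine Finset.sum_eq_zero fun u _ => ?_
    rw [← mul_zero (D u * k u.2), ← h.sum_mul_eq_zero fun y => cyc b u.1 y, Finset.mul_sum]
    exact Finset.sum_congr rfl fun v _ => by ring
  have e2 : ∑ u ∈ T, ∑ v ∈ T, D u * D v * (cyc b u.1 v.1 * k v.2) = 0 := by
    rw [Finset.sum_comm]
    refine Finset.sum_eq_zero fun v _ => ?_
    rw [← mul_zero (D v * k v.2), ← h.sum_mul_eq_zero fun y => cyc b y v.1, Finset.mul_sum]
    exact Finset.sum_congr rfl fun u _ => by ring
  have e3 : writheSum T D b c' = writheSum T D b c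
      + ∑ u ∈ T, ∑ v ∈ T, D u * D v * (cyc b u.1 v.1 * k u.2)
      - ∑ u ∈ T, ∑ v ∈ T, D u * D v * (cyc b u.1 v.1 * k v.2) := by
    simp only [writheSum, ← Finset.sum_add_distrib, ← Finset.sum_sub_distrib, hk]
    refine Finset.sum_congr rfl fun u _ => Finset.sum_congr rfl fun v _ => by ring
  rw [e3, e1, e2]; ring

lemma edgeSum_change {T : Finset Torus} {D : Torus → ℤ} {f g : Torus → Real.Angle}
    (hf : Balanced T D f) (hg : Balanced T D g) (b b' : Real.Angle) :
    edgeSum T D f g b' = edgeSum T D f g b := by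
  obtain ⟨k, hk⟩ := cyc_change_base b b'
  have e1 : ∑ u ∈ T, ∑ v ∈ T, D u * (D v ^ 2 * if f u = f v then k (g u) else 0) = 0 := by
    have : ∀ u ∈ T, ∑ v ∈ T, D u * (D v ^ 2 * if f u = f v then k (g u) else 0)
        = D u * (2 * k (g u)) := by
      intro u hu
      have := hf.mul_sum_fiber u hu
      calc _ = (D u * ∑ v ∈ T, (if f u = f v then D v ^ 2 else 0)) * k (g u) := by
            rw [Finset.mul_sum, Finset.sum_mul]
            exact Finset.sum_congr rfl fun v _ => by split_ifs <;> ring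
        _ = _ := by rw [this]; ring
    rw [Finset.sum_congr rfl this]
    exact hg.sum_mul_eq_zero fun y => 2 * k y
  have e2 : ∑ u ∈ T, ∑ v ∈ T, D u * (D v ^ 2 * if f u = f v then k (g v) else 0) = 0 := by
    rw [Finset.sum_comm]
    refine Finset.sum_eq_zero fun v _ => ?_
    calc _ = D v ^ 2 * k (g v) * ∑ u ∈ T, D u * (if f u = f v then 1 else 0) := by
          rw [Finset.mul_sum]
          exact Finset.sum_congr rfl fun u _ => by split_ifs <;> ring
      _ = 0 := by rw [hf.sum_mul_eq_zero fun y => if y = f v then 1 else 0, mul_zero]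
  have e3 : edgeSum T D f g b' = edgeSum T D f g b
      + ∑ u ∈ T, ∑ v ∈ T, D u * (D v ^ 2 * if f u = f v then k (g u) else 0)
      - ∑ u ∈ T, ∑ v ∈ T, D u * (D v ^ 2 * if f u = f v then k (g v) else 0) := by
    simp only [edgeSum, ← Finset.sum_add_distrib, ← Finset.sum_sub_distrib, hk]
    refine Finset.sum_congr rfl fun u _ => Finset.sum_congr rfl fun v _ => ?_
    split_ifs <;> ring
  rw [e3, e1, e2]; ring

/-! ### Variation of the sums across a rectangle -/

lemma sum_eq_corners {T : Finset Torus} {t1 t2 p1 p2 : Real.Angle} (ht : t1 ≠ t2) (hp : p1 ≠ p2)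
    (hT : corners t1 t2 p1 p2 ⊆ T) {F : Torus → ℤ}
    (hF : ∀ v ∈ T, v ∉ corners t1 t2 p1 p2 → F v = 0) :
    ∑ v ∈ T, F v = F (t1, p1) + F (t1, p2) + F (t2, p1) + F (t2, p2) := by
  rw [← Finset.sum_subset hT hF, corners, Finset.sum_insert, Finset.sum_insert,
    Finset.sum_insert, Finset.sum_singleton]
  · ring
  all_goals simp [ht, hp, hp.symm]

/-- `T` meets the rectangle `[t1;t2] × [p1;p2]` exactly in its four corners. -/
structure EmptyRect (T : Finset Torus) (t1 t2 p1 p2 : Real.Angle) : Prop where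
  ne_fst : t1 ≠ t2
  ne_snd : p1 ≠ p2
  subset : corners t1 t2 p1 p2 ⊆ T
  mem_corners : ∀ v ∈ T, v.1 ∈ Arc t1 t2 → v.2 ∈ Arc p1 p2 → v ∈ corners t1 t2 p1 p2

lemma writheSum_sub {T : Finset Torus} {D E : Torus → ℤ} {t1 t2 p1 p2 : Real.Angle} {m : ℤ}
    (hT : EmptyRect T t1 t2 p1 p2)
    (hm : ∀ k : Torus → ℤ, ∑ v ∈ T, (E v - D v) * k v
      = m * (k (t1, p1) - k (t1, p2) - k (t2, p1) + k (t2, p2))) :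
    writheSum T E t1 p1 - writheSum T D t1 p1
      = m * (E (t1, p1) + E (t1, p2) + E (t2, p1) + E (t2, p2)
        + (D (t1, p1) + D (t1, p2) + D (t2, p1) + D (t2, p2))) := by
  set P : (Torus → ℤ) → Torus → ℤ :=
    fun X u => ∑ v ∈ T, X v * (cyc t1 u.1 v.1 * cyc p1 u.2 v.2) with hP
  have hsq : ∀ X : Torus → ℤ, P X (t1, p1) - P X (t1, p2) - P X (t2, p1) + P X (t2, p2)
      = X (t1, p1) + X (t1, p2) + X (t2, p1) + X (t2, p2) := by
    intro X
    have : P X (t1, p1) - P X (t1, p2) - P X (t2, p1) + P X (t2, p2)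
        = ∑ v ∈ T, X v * ((cyc t1 t1 v.1 - cyc t1 t2 v.1) * (cyc p1 p1 v.2 - cyc p1 p2 v.2)) := by
      simp only [hP, ← Finset.sum_add_distrib, ← Finset.sum_sub_distrib]
      exact Finset.sum_congr rfl fun v _ => by ring
    rw [this, sum_eq_corners hT.ne_fst hT.ne_snd hT.subset]
    · simp only [cyc_sub_left hT.ne_fst, cyc_sub_right hT.ne_fst, cyc_sub_left hT.ne_snd,
        cyc_sub_right hT.ne_snd]
      ring
    · intro v hv hvc
      by_cases h1 : v.1 ∈ Arc t1 t2
      · by_cases h2 : v.2 ∈ Arc p1 p2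
        · exact absurd (hT.mem_corners v hv h1 h2) hvc
        · rw [cyc_sub_eq_zero h2]; ring
      · rw [cyc_sub_eq_zero h1]; ring
  have e : writheSum T E t1 p1 - writheSum T D t1 p1
      = ∑ u ∈ T, (E u - D u) * P E u + ∑ u ∈ T, (E u - D u) * P D u := by
    have e1 : ∑ u ∈ T, (E u - D u) * P D u
        = ∑ u ∈ T, ∑ v ∈ T, D u * (E v - D v) * (cyc t1 u.1 v.1 * cyc p1 u.2 v.2) := by
      rw [Finset.sum_comm]
      simp only [hP, Finset.mul_sum]
      refine Finset.sum_congr rfl fun u _ => Finset.sum_congr rfl fun v _ => ?_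
      rw [cyc_swap t1 u.1 v.1, cyc_swap p1 u.2 v.2]; ring
    rw [e1]
    simp only [hP, writheSum, Finset.mul_sum, ← Finset.sum_add_distrib, ← Finset.sum_sub_distrib]
    exact Finset.sum_congr rfl fun u _ => Finset.sum_congr rfl fun v _ => by ring
  rw [e, hm, hm, hsq, hsq]; ring

lemma sum_fiber_cyc_sub {T : Finset Torus} {f g : Torus → Real.Angle} {t p1 p2 : Real.Angle}
    (hp : p1 ≠ p2) {a b : Torus} (ha : a ∈ T) (hb : b ∈ T) (hfa : f a = t) (hfb : f b = t)
    (hga : g a = p1) (hgb : g b = p2)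
    (h : ∀ v ∈ T, f v = t → g v ∈ Arc p1 p2 → v = a ∨ v = b) (X : Torus → ℤ) :
    ∑ v ∈ T, X v * (if t = f v then cyc p1 p1 (g v) - cyc p1 p2 (g v) else 0) = X a + X b := by
  have hab : a ≠ b := by rintro rfl; exact hp (hga.symm.trans hgb)
  have hsub : ({a, b} : Finset Torus) ⊆ T := by
    intro x hx
    rcases Finset.mem_insert.1 hx with rfl | hx
    · exact ha
    · rw [Finset.mem_singleton.1 hx]; exact hb
  rw [← Finset.sum_subset hsub, Finset.sum_pair hab, hfa, hfb, hga, hgb, cyc_sub_left hp,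
    cyc_sub_right hp]
  · simp
  · intro v hv hv'
    split_ifs with ht
    · rw [cyc_sub_eq_zero, mul_zero]
      intro hg
      apply hv'
      rcases h v hv ht.symm hg with rfl | rfl <;> simp
    · exact mul_zero _

lemma edgeSum_sub {T : Finset Torus} {D E : Torus → ℤ} {f g : Torus → Real.Angle}
    {t1 t2 p1 p2 : Real.Angle} {m : ℤ} (hD : Balanced T D f) {a b c d : Torus}
    (hp : p1 ≠ p2) (ha : a ∈ T) (hb : b ∈ T) (hc : c ∈ T) (hd : d ∈ T)
    (hfa : f a = t1) (hfb : f b = t1) (hfc : f c = t2) (hfd : f d = t2)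
    (hga : g a = p1) (hgb : g b = p2) (hgc : g c = p1) (hgd : g d = p2)
    (h1 : ∀ v ∈ T, f v = t1 → g v ∈ Arc p1 p2 → v = a ∨ v = b)
    (h2 : ∀ v ∈ T, f v = t2 → g v ∈ Arc p1 p2 → v = c ∨ v = d)
    (hm : ∀ k : Torus → ℤ, ∑ v ∈ T, (E v - D v) * k v = m * (k a - k b - k c + k d))
    (hq : ∀ k : Torus → ℤ, ∑ v ∈ T, (E v ^ 2 - D v ^ 2) * k v
      = (E a ^ 2 - D a ^ 2) * k a + (E b ^ 2 - D b ^ 2) * k b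
        + (E c ^ 2 - D c ^ 2) * k c + (E d ^ 2 - D d ^ 2) * k d) :
    edgeSum T E f g p1 - edgeSum T D f g p1
      = m * (E a ^ 2 + E b ^ 2 - E c ^ 2 - E d ^ 2)
        + (E a ^ 2 - D a ^ 2) * D a + (E b ^ 2 - D b ^ 2) * (D a + (D a + D b))
        + (E c ^ 2 - D c ^ 2) * D c + (E d ^ 2 - D d ^ 2) * (D c + (D c + D d)) := by
  set P : Torus → ℤ :=
    fun u => ∑ v ∈ T, E v ^ 2 * (if f u = f v then cyc p1 (g u) (g v) else 0) with hP
  set Q : Torus → ℤ :=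
    fun v => ∑ u ∈ T, D u * (if f u = f v then cyc p1 (g u) (g v) else 0) with hQ
  have e : edgeSum T E f g p1 - edgeSum T D f g p1
      = ∑ u ∈ T, (E u - D u) * P u + ∑ v ∈ T, (E v ^ 2 - D v ^ 2) * Q v := by
    have e1 : ∑ v ∈ T, (E v ^ 2 - D v ^ 2) * Q v = ∑ u ∈ T, ∑ v ∈ T,
        (E v ^ 2 - D v ^ 2) * (D u * (if f u = f v then cyc p1 (g u) (g v) else 0)) := by
      rw [Finset.sum_comm]
      simp only [hQ, Finset.mul_sum]
    rw [e1]
    simp only [hP, edgeSum, Finset.mul_sum, ← Finset.sum_add_distrib, ← Finset.sum_sub_distrib]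
    exact Finset.sum_congr rfl fun u _ => Finset.sum_congr rfl fun v _ => by ring
  have line1 := sum_fiber_cyc_sub hp ha hb hfa hfb hga hgb h1
  have line2 := sum_fiber_cyc_sub hp hc hd hfc hfd hgc hgd h2
  have hP1 : P a - P b = E a ^ 2 + E b ^ 2 := by
    rw [← line1 fun v => E v ^ 2]
    simp only [hP, hfa, hfb, hga, hgb, ← Finset.sum_sub_distrib]
    exact Finset.sum_congr rfl fun v _ => by split_ifs <;> ring
  have hP2 : P c - P d = E c ^ 2 + E d ^ 2 := by
    rw [← line2 fun v => E v ^ 2]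
    simp only [hP, hfc, hfd, hgc, hgd, ← Finset.sum_sub_distrib]
    exact Finset.sum_congr rfl fun v _ => by split_ifs <;> ring
  have hQ1 : Q b - Q a = D a + D b := by
    rw [← line1 D]
    simp only [hQ, hfa, hfb, hga, hgb, ← Finset.sum_sub_distrib]
    refine Finset.sum_congr rfl fun v _ => ?_
    rw [cyc_swap p1 p1 (g v), cyc_swap p1 p2 (g v)]
    simp only [eq_comm (a := f v)]
    split_ifs <;> ring
  have hQ2 : Q d - Q c = D c + D d := by
    rw [← line2 D]
    simp only [hQ, hfc, hfd, hgc, hgd, ← Finset.sum_sub_distrib]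
    refine Finset.sum_congr rfl fun v _ => ?_
    rw [cyc_swap p1 p1 (g v), cyc_swap p1 p2 (g v)]
    simp only [eq_comm (a := f v)]
    split_ifs <;> ring
  have hbase : ∀ (t : Real.Angle) (x y : Torus), x ∈ T → f x = t → g x = p1 →
      (∀ v ∈ T, f v = t → g v ∈ Arc p1 p2 → v = x ∨ v = y) → g y = p2 → Q x = D x := by
    intro t x y hx hfx hgx h hgy
    have e1 : Q x + ∑ u ∈ T, D u * (if f u = t then 1 else 0)
        = ∑ u ∈ T, if u = x then D u else 0 := by
      simp only [hQ, hfx, hgx, ← Finset.sum_add_distrib]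
      refine Finset.sum_congr rfl fun u hu => ?_
      by_cases hux : u = x
      · subst hux
        simp [hfx, hgx, cyc_self]
      · by_cases hft : f u = t
        · have hgu : g u ≠ p1 := by
            intro hgu
            have hmem : g u ∈ Arc p1 p2 := by
              rw [hgu]
              apply mem_Arc_of_arcLen_le
              rw [arcLen_self]
              exact arcLen_nonneg _ _
            rcases h u hu hft hmem with h' | h'
            · exact hux h'
            · exact hp (by rw [← hgu, h', hgy])
          simp [hux, hft, cyc_base_left hgu]
        · simp [hux, hft]
    rw [hD.sum_mul_eq_zero fun y => if y = t then 1 else 0, Finset.sum_ite_eq' T x D,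
      if_pos hx] at e1
    linarith
  have hQa : Q a = D a := hbase t1 a b ha hfa hga h1 hgb
  have hQc : Q c = D c := hbase t2 c d hc hfc hgc h2 hgd
  have hQb : Q b = D a + (D a + D b) := by linarith
  have hQd : Q d = D c + (D c + D d) := by linarith
  rw [e, hm, hq, hQa, hQb, hQc, hQd]
  have : P a - P b - P c + P d = E a ^ 2 + E b ^ 2 - E c ^ 2 - E d ^ 2 := by linarith
  rw [this]; ring

/-! ### The weights of a component of a diagram -/

/-- The condition common to `MeridianOK` and `LongitudeOK`, for the fibres of `f`. -/
def LineOK (f : Torus → Real.Angle) (V : Finset Torus) (sgn : Torus → Bool) : Prop :=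
  ∀ θ : Real.Angle, (∀ v ∈ V, f v ≠ θ) ∨
    ∃ u w, u ∈ V ∧ w ∈ V ∧ u ≠ w ∧ f u = θ ∧ f w = θ ∧ sgn u ≠ sgn w ∧
      ∀ x ∈ V, f x = θ → x = u ∨ x = w

lemma IsDiagSet.lineOK {V : Finset Torus} {sgn : Torus → Bool} (h : IsDiagSet V sgn)
    {f : Torus → Real.Angle} (hf : f = Prod.fst ∨ f = Prod.snd) : LineOK f V sgn := by
  rcases hf with rfl | rfl
  · exact h.1
  · exact h.2

lemma comp_eq_of_line (R : RectDiagram) {f : Torus → Real.Angle}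
    (hf : f = Prod.fst ∨ f = Prod.snd) {u v : Torus} (hu : u ∈ R.verts) (hv : v ∈ R.verts)
    (h : f u = f v) : R.comp u = R.comp v := by
  obtain ⟨S, hS, huS, -⟩ := (R.comp_eq_iff u hu u hu).1 rfl
  refine (R.comp_eq_iff u hu v hv).2 ⟨S, hS, huS, ?_⟩
  rcases hS.2.2.1.lineOK hf (f u) with h0 | ⟨a, b, ha, hb, hab, hfa, hfb, -, -⟩
  · exact absurd rfl (h0 u huS)
  rcases R.diag.lineOK hf (f u) with h0 | ⟨a', b', -, -, -, -, -, -, hall⟩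
  · exact absurd rfl (h0 u hu)
  have h1 := hall a (hS.1 ha) hfa
  have h2 := hall b (hS.1 hb) hfb
  have h3 := hall v hv h.symm
  grind

/-- The sign of the vertex `v` if it lies in the component number `i` of `R`, zero otherwise. -/
def weight (R : RectDiagram) (i : ℕ) (v : Torus) : ℤ :=
  if v ∈ R.verts ∧ R.comp v = i then (if R.sgn v then 1 else -1) else 0

lemma weight_of_notMem {R : RectDiagram} {v : Torus} (i : ℕ) (h : v ∉ R.verts) :
    weight R i v = 0 := by
  simp [weight, h]

lemma weight_of_mem {R : RectDiagram} {v : Torus} {i : ℕ} (h : v ∈ R.verts)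
    (hi : R.comp v = i) : weight R i v = if R.sgn v then 1 else -1 := by
  simp only [weight, h, hi, and_self, if_true]

lemma weight_eq_zero_iff {R : RectDiagram} {v : Torus} {i : ℕ} (h : v ∈ R.verts) :
    weight R i v = 0 ↔ i ≠ R.comp v := by
  by_cases hi : R.comp v = i
  · rw [weight_of_mem h hi]
    simp only [hi, ne_eq, not_true, iff_false]
    split_ifs <;> norm_num
  · simp [weight, hi, Ne.symm hi]

lemma weight_of_sgn_true {R : RectDiagram} {v : Torus} (i : ℕ) (h : R.sgn v = true) :
    weight R i v = 0 ∨ weight R i v = 1 := by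
  unfold weight
  split_ifs <;> simp_all

lemma weight_of_sgn_false {R : RectDiagram} {v : Torus} (i : ℕ) (h : R.sgn v = false) :
    weight R i v = 0 ∨ weight R i v = -1 := by
  unfold weight
  split_ifs <;> simp_all

lemma weight_fiber (R : RectDiagram) (i : ℕ) {f : Torus → Real.Angle}
    (hf : f = Prod.fst ∨ f = Prod.snd) (θ : Real.Angle) :
    (∀ v, f v = θ → weight R i v = 0) ∨
      ∃ a b, a ∈ R.verts ∧ b ∈ R.verts ∧ a ≠ b ∧ f a = θ ∧ f b = θ ∧
        weight R i a = -weight R i b ∧ weight R i a ^ 2 = 1 ∧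
        ∀ v, f v = θ → weight R i v ≠ 0 → v = a ∨ v = b := by
  rcases R.diag.lineOK hf θ with h0 | ⟨a, b, ha, hb, hab, hfa, hfb, hs, hall⟩
  · exact Or.inl fun v hv => weight_of_notMem i fun hv' => h0 v hv' hv
  have hcomp := comp_eq_of_line R hf ha hb (hfa.trans hfb.symm)
  by_cases hi : R.comp a = i
  · refine Or.inr ⟨a, b, ha, hb, hab, hfa, hfb, ?_, ?_, fun v hv hw => ?_⟩
    · rw [weight_of_mem ha hi, weight_of_mem hb (hcomp.symm.trans hi)]
      cases h1 : R.sgn a <;> cases h2 : R.sgn b <;> simp [h1, h2] at hs ⊢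
    · rw [weight_of_mem ha hi]
      split_ifs <;> norm_num
    · exact hall v (by_contra fun h => hw (weight_of_notMem i h)) hv
  · refine Or.inl fun v hv => ?_
    by_cases hvR : v ∈ R.verts
    · rw [weight_eq_zero_iff hvR]
      rintro rfl
      exact hi (comp_eq_of_line R hf ha hvR (hfa.trans hv.symm))
    · exact weight_of_notMem i hvR

lemma sum_filter_pair {T : Finset Torus} {f : Torus → Real.Angle} {θ : Real.Angle} {a b : Torus}
    (ha : a ∈ T) (hb : b ∈ T) (hab : a ≠ b) (hfa : f a = θ) (hfb : f b = θ) {F : Torus → ℤ}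
    (hF : ∀ v ∈ T, f v = θ → v ≠ a → v ≠ b → F v = 0) :
    ∑ v ∈ T with f v = θ, F v = F a + F b := by
  rw [← Finset.sum_pair hab]
  symm
  apply Finset.sum_subset
  · intro x hx
    rcases Finset.mem_insert.1 hx with rfl | hx
    · simp [ha, hfa]
    · rw [Finset.mem_singleton.1 hx]
      simp [hb, hfb]
  · intro v hv hv'
    simp only [Finset.mem_filter, Finset.mem_insert, Finset.mem_singleton, not_or] at hv hv'
    exact hF v hv.1 hv.2 hv'.1 hv'.2

lemma weight_balanced (R : RectDiagram) (i : ℕ) {f : Torus → Real.Angle}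
    (hf : f = Prod.fst ∨ f = Prod.snd) {T : Finset Torus} (hT : R.verts ⊆ T) :
    Balanced T (weight R i) f where
  sum_mul_eq_zero k := by
    rw [← Finset.sum_fiberwise_of_maps_to
      (fun u (hu : u ∈ T) => Finset.mem_image_of_mem f hu)]
    refine Finset.sum_eq_zero fun θ _ => ?_
    rcases weight_fiber R i hf θ with h | ⟨a, b, ha, hb, hab, hfa, hfb, hw, -, hall⟩
    · refine Finset.sum_eq_zero fun u hu => ?_
      rw [h u (Finset.mem_filter.1 hu).2, zero_mul]
    · rw [sum_filter_pair (hT ha) (hT hb) hab hfa hfb, hfa, hfb, hw]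
      · ring
      · intro v _ hv hva hvb
        by_contra h
        rcases hall v hv (left_ne_zero_of_mul h) with h | h
        · exact hva h
        · exact hvb h
  mul_sum_fiber u _ := by
    by_cases hu : weight R i u = 0
    · rw [hu]; ring
    rcases weight_fiber R i hf (f u) with h | ⟨a, b, ha, hb, hab, hfa, hfb, hw, hsq, hall⟩
    · exact absurd (h u rfl) hu
    · simp only [eq_comm (a := f u)]
      rw [← Finset.sum_filter, sum_filter_pair (hT ha) (hT hb) hab hfa hfb]
      · have : weight R i b ^ 2 = 1 := by rw [hw] at hsq; simpa using hsq
        rw [hsq, this]; ring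
      · intro v _ hv hva hvb
        by_contra h
        rcases hall v hv (fun h' => h (by rw [h']; rfl)) with h | h
        · exact hva h
        · exact hvb h

lemma writheSum_weight (R : RectDiagram) (i : ℕ) {T : Finset Torus} (hT : R.verts ⊆ T)
    (b c : Real.Angle) : writheSum T (weight R i) b c = writheSum R.verts (weight R i) b c := by
  unfold writheSum
  rw [← Finset.sum_subset hT fun u _ hu => Finset.sum_eq_zero fun v _ => by
    rw [weight_of_notMem i hu]; ring]
  exact Finset.sum_congr rfl fun u _ => (Finset.sum_subset hT fun v _ hv => by
    rw [weight_of_notMem i hv]; ring).symm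

lemma edgeSum_weight (R : RectDiagram) (i : ℕ) {T : Finset Torus} (hT : R.verts ⊆ T)
    (f g : Torus → Real.Angle) (b : Real.Angle) :
    edgeSum T (weight R i) f g b = edgeSum R.verts (weight R i) f g b := by
  unfold edgeSum
  rw [← Finset.sum_subset hT fun u _ hu => Finset.sum_eq_zero fun v _ => by
    rw [weight_of_notMem i hu]; ring]
  exact Finset.sum_congr rfl fun u _ => (Finset.sum_subset hT fun v _ hv => by
    rw [weight_of_notMem i hv]; ring).symm

/-! ### Integer invariants of components -/

/-- The number of vertices of the component number `i`. -/
def size (R : RectDiagram) (i : ℕ) : ℤ := ∑ v ∈ R.verts, weight R i v ^ 2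

/-- The normalized writhe of the component number `i`. -/
def writhe (R : RectDiagram) (i : ℕ) : ℤ := writheSum R.verts (weight R i) 0 0

/-- The signed count of the vertical edges of the component number `i`. -/
def vertical (R : RectDiagram) (i : ℕ) : ℤ :=
  edgeSum R.verts (weight R i) Prod.fst Prod.snd 0

/-- The signed count of the horizontal edges of the component number `i`. -/
def horizontal (R : RectDiagram) (i : ℕ) : ℤ :=
  edgeSum R.verts (weight R i) Prod.snd Prod.fst 0

lemma size_eq (R : RectDiagram) (i : ℕ) {T : Finset Torus} (hT : R.verts ⊆ T) :
    size R i = ∑ v ∈ T, weight R i v ^ 2 :=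
  Finset.sum_subset hT fun v _ hv => by rw [weight_of_notMem i hv]; rfl

lemma writhe_eq (R : RectDiagram) (i : ℕ) {T : Finset Torus} (hT : R.verts ⊆ T)
    (b c : Real.Angle) : writhe R i = writheSum T (weight R i) b c := by
  rw [writhe, ← writheSum_weight R i hT,
    writheSum_change_fst (weight_balanced R i (Or.inr rfl) hT) b,
    writheSum_change_snd (weight_balanced R i (Or.inl rfl) hT) b c]

lemma vertical_eq (R : RectDiagram) (i : ℕ) {T : Finset Torus} (hT : R.verts ⊆ T)
    (b : Real.Angle) : vertical R i = edgeSum T (weight R i) Prod.fst Prod.snd b := by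
  rw [vertical, ← edgeSum_weight R i hT]
  exact edgeSum_change (weight_balanced R i (Or.inl rfl) hT)
    (weight_balanced R i (Or.inr rfl) hT) _ _

lemma horizontal_eq (R : RectDiagram) (i : ℕ) {T : Finset Torus} (hT : R.verts ⊆ T)
    (b : Real.Angle) : horizontal R i = edgeSum T (weight R i) Prod.snd Prod.fst b := by
  rw [horizontal, ← edgeSum_weight R i hT]
  exact edgeSum_change (weight_balanced R i (Or.inr rfl) hT)
    (weight_balanced R i (Or.inl rfl) hT) _ _

/-! ### Elementary moves -/

section Move

variable {R S : RectDiagram} {t1 t2 p1 p2 : Real.Angle}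

lemma mem_corners {v : Torus} : v ∈ corners t1 t2 p1 p2 ↔
    v = (t1, p1) ∨ v = (t1, p2) ∨ v = (t2, p1) ∨ v = (t2, p2) := by
  simp [corners]

lemma IsElemMoveWith.mem_corners_iff (h : IsElemMoveWith R S t1 t2 p1 p2) (v : Torus) :
    v ∈ corners t1 t2 p1 p2 ↔ v ∈ R.verts ∧ v ∉ S.verts ∨ v ∈ S.verts ∧ v ∉ R.verts := by
  rw [← h.2.2.1, Finset.mem_symmDiff]

lemma IsElemMoveWith.emptyRect (h : IsElemMoveWith R S t1 t2 p1 p2) :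
    EmptyRect (R.verts ∪ S.verts) t1 t2 p1 p2 where
  ne_fst := h.1
  ne_snd := h.2.1
  subset v hv := by
    rw [h.mem_corners_iff] at hv
    rw [Finset.mem_union]
    tauto
  mem_corners v hv h1 h2 := by
    have h3 : v ∈ RectSet t1 t2 p1 p2 ∩ (↑R.verts ∪ ↑S.verts) :=
      ⟨⟨h1, h2⟩, by simpa using hv⟩
    rw [h.2.2.2.2.2.2.1] at h3
    simpa using h3

lemma IsElemMoveWith.weight_eq (h : IsElemMoveWith R S t1 t2 p1 p2) (i : ℕ) {v : Torus}
    (hv : v ∉ corners t1 t2 p1 p2) : weight S i v = weight R i v := by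
  rw [h.mem_corners_iff] at hv
  by_cases hR : v ∈ R.verts
  · have hS : v ∈ S.verts := by tauto
    have := h.2.2.2.2.2.2.2 v (Finset.mem_inter.2 ⟨hR, hS⟩)
    simp [weight, hR, hS, this.1, this.2]
  · have hS : v ∉ S.verts := by tauto
    rw [weight_of_notMem i hR, weight_of_notMem i hS]

/-- The weights of the two diagrams of an elementary move differ by a multiple of the
alternating sum of the corners of the rectangle. -/
lemma IsElemMoveWith.exists_weight_sub (h : IsElemMoveWith R S t1 t2 p1 p2) (i : ℕ) :
    ∃ m : ℤ, weight S i (t1, p1) = weight R i (t1, p1) + m ∧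
      weight S i (t1, p2) = weight R i (t1, p2) - m ∧
      weight S i (t2, p1) = weight R i (t2, p1) - m ∧
      weight S i (t2, p2) = weight R i (t2, p2) + m := by
  have hrect := h.emptyRect
  have key : ∀ (f : Torus → Real.Angle), (f = Prod.fst ∨ f = Prod.snd) →
      ∀ k : Real.Angle → ℤ,
        (weight S i (t1, p1) - weight R i (t1, p1)) * k (f (t1, p1))
        + (weight S i (t1, p2) - weight R i (t1, p2)) * k (f (t1, p2))
        + (weight S i (t2, p1) - weight R i (t2, p1)) * k (f (t2, p1))
        + (weight S i (t2, p2) - weight R i (t2, p2)) * k (f (t2, p2)) = 0 := by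
    intro f hf k
    have e1 := (weight_balanced R i hf
      (Finset.subset_union_left (s₂ := S.verts))).sum_mul_eq_zero k
    have e2 := (weight_balanced S i hf
      (Finset.subset_union_right (s₁ := R.verts))).sum_mul_eq_zero k
    rw [← sum_eq_corners (F := fun v => (weight S i v - weight R i v) * k (f v))
      hrect.ne_fst hrect.ne_snd hrect.subset]
    · simp only [sub_mul, Finset.sum_sub_distrib, e1, e2, sub_zero]
    · intro v _ hv
      rw [h.weight_eq i hv]; ring
  have k1 := key Prod.fst (Or.inl rfl) fun x => if x = t1 then 1 else 0
  have k2 := key Prod.fst (Or.inl rfl) fun x => if x = t2 then 1 else 0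
  have k3 := key Prod.snd (Or.inr rfl) fun x => if x = p1 then 1 else 0
  simp only [hrect.ne_fst, hrect.ne_fst.symm, hrect.ne_snd.symm, if_true, if_false] at k1 k2 k3
  refine ⟨weight S i (t1, p1) - weight R i (t1, p1), ?_, ?_, ?_, ?_⟩ <;> linarith

/-- The variation of the invariants under an elementary move, in terms of the weights at the
corners of the rectangle. -/
lemma IsElemMoveWith.invariants_sub (h : IsElemMoveWith R S t1 t2 p1 p2) (i : ℕ) {m : ℤ}
    {a b c d a' b' c' d' : ℤ}
    (ha : weight R i (t1, p1) = a) (hb : weight R i (t1, p2) = b)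
    (hc : weight R i (t2, p1) = c) (hd : weight R i (t2, p2) = d)
    (ha' : weight S i (t1, p1) = a') (hb' : weight S i (t1, p2) = b')
    (hc' : weight S i (t2, p1) = c') (hd' : weight S i (t2, p2) = d')
    (hma : a' = a + m) (hmb : b' = b - m) (hmc : c' = c - m) (hmd : d' = d + m) :
    size S i = size R i
        + ((a' ^ 2 - a ^ 2) + (b' ^ 2 - b ^ 2) + (c' ^ 2 - c ^ 2) + (d' ^ 2 - d ^ 2)) ∧
      writhe S i = writhe R i + m * (a' + b' + c' + d' + (a + b + c + d)) ∧
      vertical S i = vertical R i + (m * (a' ^ 2 + b' ^ 2 - c' ^ 2 - d' ^ 2)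
        + (a' ^ 2 - a ^ 2) * a + (b' ^ 2 - b ^ 2) * (a + (a + b))
        + (c' ^ 2 - c ^ 2) * c + (d' ^ 2 - d ^ 2) * (c + (c + d))) ∧
      horizontal S i = horizontal R i + (m * (a' ^ 2 + c' ^ 2 - b' ^ 2 - d' ^ 2)
        + (a' ^ 2 - a ^ 2) * a + (c' ^ 2 - c ^ 2) * (a + (a + c))
        + (b' ^ 2 - b ^ 2) * b + (d' ^ 2 - d ^ 2) * (b + (b + d))) := by
  have hrect := h.emptyRect
  have hR : R.verts ⊆ R.verts ∪ S.verts := Finset.subset_union_left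
  have hS : S.verts ⊆ R.verts ∪ S.verts := Finset.subset_union_right
  set T := R.verts ∪ S.verts
  have hm : ∀ k : Torus → ℤ, ∑ v ∈ T, (weight S i v - weight R i v) * k v
      = m * (k (t1, p1) - k (t1, p2) - k (t2, p1) + k (t2, p2)) := by
    intro k
    rw [sum_eq_corners hrect.ne_fst hrect.ne_snd hrect.subset, ha, hb, hc, hd, ha', hb', hc',
      hd', hma, hmb, hmc, hmd]
    · ring
    · intro v _ hv
      rw [h.weight_eq i hv]; ring
  have hq : ∀ k : Torus → ℤ, ∑ v ∈ T, (weight S i v ^ 2 - weight R i v ^ 2) * k v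
      = (a' ^ 2 - a ^ 2) * k (t1, p1) + (b' ^ 2 - b ^ 2) * k (t1, p2)
        + (c' ^ 2 - c ^ 2) * k (t2, p1) + (d' ^ 2 - d ^ 2) * k (t2, p2) := by
    intro k
    rw [sum_eq_corners hrect.ne_fst hrect.ne_snd hrect.subset, ha, hb, hc, hd, ha', hb', hc',
      hd']
    intro v _ hv
    rw [h.weight_eq i hv]; ring
  have mem : ∀ v, v = (t1, p1) ∨ v = (t1, p2) ∨ v = (t2, p1) ∨ v = (t2, p2) → v ∈ T :=
    fun v hv => hrect.subset (mem_corners.2 hv)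
  have arc_left : ∀ x y : Real.Angle, x ∈ Arc x y := fun x y =>
    mem_Arc_of_arcLen_le (by rw [arcLen_self]; exact arcLen_nonneg _ _)
  have arc_right : ∀ x y : Real.Angle, y ∈ Arc x y := fun x y => mem_Arc_of_arcLen_le le_rfl
  have ht := hrect.ne_fst
  have hp := hrect.ne_snd
  refine ⟨?_, ?_, ?_, ?_⟩
  · rw [size_eq S i hS, size_eq R i hR]
    have := hq fun _ => 1
    simp only [mul_one, Finset.sum_sub_distrib] at this
    linarith
  · rw [writhe_eq S i hS t1 p1, writhe_eq R i hR t1 p1]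
    have := writheSum_sub hrect hm
    rw [ha, hb, hc, hd, ha', hb', hc', hd'] at this
    linarith
  · rw [vertical_eq S i hS p1, vertical_eq R i hR p1]
    have := edgeSum_sub (E := weight S i) (g := Prod.snd) (m := m)
      (weight_balanced R i (Or.inl rfl) hR) hp
      (mem (t1, p1) (by simp)) (mem (t1, p2) (by simp)) (mem (t2, p1) (by simp))
      (mem (t2, p2) (by simp)) rfl rfl rfl rfl rfl rfl rfl rfl
      (fun v hv hv1 hv2 => by
        rcases mem_corners.1 (hrect.mem_corners v hv (hv1 ▸ arc_left t1 t2) hv2) with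
          rfl | rfl | rfl | rfl <;> simp_all)
      (fun v hv hv1 hv2 => by
        rcases mem_corners.1 (hrect.mem_corners v hv (hv1 ▸ arc_right t1 t2) hv2) with
          rfl | rfl | rfl | rfl <;> simp_all)
      hm (fun k => by rw [hq, ha, hb, hc, hd, ha', hb', hc', hd'])
    rw [ha, hb, hc, hd, ha', hb', hc', hd'] at this
    linarith
  · rw [horizontal_eq S i hS t1, horizontal_eq R i hR t1]
    have := edgeSum_sub (E := weight S i) (g := Prod.fst) (m := m)
      (weight_balanced R i (Or.inr rfl) hR) ht
      (mem (t1, p1) (by simp)) (mem (t2, p1) (by simp)) (mem (t1, p2) (by simp))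
      (mem (t2, p2) (by simp)) rfl rfl rfl rfl rfl rfl rfl rfl
      (fun v hv hv1 hv2 => by
        rcases mem_corners.1 (hrect.mem_corners v hv hv2 (hv1 ▸ arc_left p1 p2)) with
          rfl | rfl | rfl | rfl <;> simp_all)
      (fun v hv hv1 hv2 => by
        rcases mem_corners.1 (hrect.mem_corners v hv hv2 (hv1 ▸ arc_right p1 p2)) with
          rfl | rfl | rfl | rfl <;> simp_all)
      (fun k => by rw [hm]; ring)
      (fun k => by rw [hq, ha, hb, hc, hd, ha', hb', hc', hd']; ring)
    rw [ha, hb, hc, hd, ha', hb', hc', hd'] at this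
    linarith

end Move

/-- The sign distinguishing the types I and II. -/
def OType.typeSign : OType → ℤ
  | .posI => -1
  | .negI => -1
  | .posII => 1
  | .negII => 1

/-- The sign distinguishing the two orientations of a type. -/
def OType.orientSign : OType → ℤ
  | .posI => 1
  | .negI => -1
  | .posII => 1
  | .negII => -1

/-- The invariant of the component number `i` that is changed only by stabilizations and
destabilizations of oriented type `t` performed on this component. -/
def stabInvariant (t : OType) (R : RectDiagram) (i : ℕ) : ℤ :=
  size R i + t.typeSign * writhe R i
    + t.orientSign * (t.typeSign * vertical R i - horizontal R i)

/-- The two vertices removed by an exchange move are not opposite corners of the rectangle. -/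
lemma IsElemMoveWith.opposite_corners {R S : RectDiagram} {t1 t2 p1 p2 : Real.Angle}
    (h : IsElemMoveWith R S t1 t2 p1 p2) (hcard : S.verts.card = R.verts.card) :
    ((t2, p2) ∈ R.verts ↔ (t1, p1) ∉ R.verts) ∧ ((t2, p1) ∈ R.verts ↔ (t1, p2) ∉ R.verts) := by
  have hrect := h.emptyRect
  have ht := hrect.ne_fst
  have hp := hrect.ne_snd
  have ca := (h.mem_corners_iff (t1, p1)).1 (mem_corners.2 (by simp))
  have cb := (h.mem_corners_iff (t1, p2)).1 (mem_corners.2 (by simp))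
  have cc := (h.mem_corners_iff (t2, p1)).1 (mem_corners.2 (by simp))
  have cd := (h.mem_corners_iff (t2, p2)).1 (mem_corners.2 (by simp))
  have hsum : ∑ v ∈ R.verts ∪ S.verts,
      ((if v ∈ S.verts then (1 : ℤ) else 0) - (if v ∈ R.verts then 1 else 0)) = 0 := by
    rw [Finset.sum_sub_distrib, Finset.sum_ite_mem, Finset.sum_ite_mem,
      Finset.inter_eq_right.2 Finset.subset_union_left,
      Finset.inter_eq_right.2 Finset.subset_union_right]
    simp [hcard]
  rw [sum_eq_corners ht hp hrect.subset] at hsum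
  swap
  · intro v _ hv
    rw [h.mem_corners_iff] at hv
    by_cases h1 : v ∈ R.verts <;> by_cases h2 : v ∈ S.verts <;> simp_all
  obtain ⟨u, v, hu, hv, huv⟩ := h.2.2.2.1
  rw [h.2.2.1, mem_corners] at hu hv
  have hedge : ∀ Q : RectDiagram, IsEdge Q u v →
      ¬ ((t1, p1) ∉ Q.verts ∧ (t2, p2) ∉ Q.verts) ∧
      ¬ ((t1, p2) ∉ Q.verts ∧ (t2, p1) ∉ Q.verts) := by
    rintro Q ⟨h1, h2, h3, h4⟩
    clear hsum huv ca cb cc cd hcard hrect h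
    have ht' := ht.symm
    have hp' := hp.symm
    rcases hu with rfl | rfl | rfl | rfl <;> rcases hv with rfl | rfl | rfl | rfl <;> simp_all
  have hdiag : (¬ ((t1, p1) ∉ R.verts ∧ (t2, p2) ∉ R.verts) ∧
      ¬ ((t1, p2) ∉ R.verts ∧ (t2, p1) ∉ R.verts)) ∨
      (¬ ((t1, p1) ∉ S.verts ∧ (t2, p2) ∉ S.verts) ∧
      ¬ ((t1, p2) ∉ S.verts ∧ (t2, p1) ∉ S.verts)) := huv.imp (hedge R) (hedge S)
  clear hedge huv hu hv h hrect
  rcases ca with ⟨xa, ya⟩ | ⟨xa, ya⟩ <;> rcases cb with ⟨xb, yb⟩ | ⟨xb, yb⟩ <;>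
  rcases cc with ⟨xc, yc⟩ | ⟨xc, yc⟩ <;> rcases cd with ⟨xd, yd⟩ | ⟨xd, yd⟩ <;>
  simp [xa, ya, xb, yb, xc, yc, xd, yd] at hsum hdiag ⊢

lemma IsExchange.stabInvariant_eq {R S : RectDiagram} (h : IsExchange R S) (t : OType) (i : ℕ) :
    stabInvariant t S i = stabInvariant t R i := by
  obtain ⟨⟨t1, t2, p1, p2, h⟩, hcard⟩ := h
  obtain ⟨m, ha, hb, hc, hd⟩ := h.exists_weight_sub i
  obtain ⟨i1, i2, i3, i4⟩ :=
    h.invariants_sub i rfl rfl rfl rfl rfl rfl rfl rfl ha hb hc hd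
  obtain ⟨had, hbc⟩ := h.opposite_corners hcard
  have val : ∀ w ∈ corners t1 t2 p1 p2, ∀ e : ℤ, weight S i w = weight R i w + e →
      weight R i w = if w ∈ R.verts then -e else 0 := by
    intro w hw e he
    rcases (h.mem_corners_iff w).1 hw with ⟨h1, h2⟩ | ⟨h1, h2⟩
    · rw [weight_of_notMem i h2] at he
      rw [if_pos h1]; linarith
    · rw [weight_of_notMem i h2, if_neg h2]
  have va := val (t1, p1) (mem_corners.2 (by simp)) m ha
  have vb := val (t1, p2) (mem_corners.2 (by simp)) (-m) (by rw [hb]; ring)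
  have vc := val (t2, p1) (mem_corners.2 (by simp)) (-m) (by rw [hc]; ring)
  have vd := val (t2, p2) (mem_corners.2 (by simp)) m hd
  simp only [had] at vd
  simp only [hbc] at vc
  unfold stabInvariant
  rw [i1, i2, i3, i4, ha, hb, hc, hd, va, vb, vc, vd]
  by_cases xa : (t1, p1) ∈ R.verts <;> by_cases xb : (t1, p2) ∈ R.verts <;>
    simp only [xa, xb, not_true, not_false_iff, if_true, if_false] <;> ring

/-- Stabilizations of type `t` increase the corresponding invariant of the modified component
by `8` and preserve the invariants of the other types and of the other components. -/
lemma IsStabOfOType.stabInvariant_eq {R S : RectDiagram} {t : OType} (h : IsStabOfOType R S t)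
    {j : ℕ} (hj : ModifiesComp R S j ∨ ModifiesComp S R j) (t' : OType) (i : ℕ) :
    stabInvariant t' S i = stabInvariant t' R i + if t' = t ∧ i = j then 8 else 0 := by
  obtain ⟨t1, t2, p1, p2, ⟨h, -⟩, p0, hp0, hleft, hright, htype⟩ := h
  obtain ⟨m, ha, hb, hc, hd⟩ := h.exists_weight_sub i
  have hmod : m = 0 ↔ i ≠ j := by
    have aux : ∃ v ∈ corners t1 t2 p1 p2, weight S i v = weight R i v ↔ i ≠ j := by
      rcases hj with ⟨v, h1, h2, rfl⟩ | ⟨v, h1, h2, rfl⟩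
      · refine ⟨v, (h.mem_corners_iff v).2 (Or.inl ⟨h1, h2⟩), ?_⟩
        rw [weight_of_notMem i h2, eq_comm, weight_eq_zero_iff h1]
      · refine ⟨v, (h.mem_corners_iff v).2 (Or.inr ⟨h1, h2⟩), ?_⟩
        rw [weight_of_notMem i h2, weight_eq_zero_iff h1]
    obtain ⟨v, hv, hiff⟩ := aux
    rw [← hiff]
    rcases mem_corners.1 hv with rfl | rfl | rfl | rfl
    · rw [ha]; omega
    · rw [hb]; omega
    · rw [hc]; omega
    · rw [hd]; omega
  have inv := h.invariants_sub i rfl rfl rfl rfl rfl rfl rfl rfl ha hb hc hd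
  have ht := h.1
  have hp := h.2.1
  obtain ⟨v, hvR, hvS⟩ := Finset.not_subset.1 h.2.2.2.2.1
  have hvw := weight_of_notMem i hvS
  have hvc := (h.mem_corners_iff v).2 (Or.inl ⟨hvR, hvS⟩)
  have hnot : ∀ w, w ∈ S.verts → w ∈ corners t1 t2 p1 p2 → weight R i w = 0 := by
    intro w hwS hw
    rcases (h.mem_corners_iff w).1 hw with h1 | h1
    · exact absurd hwS h1.2
    · exact weight_of_notMem i h1.2
  have hI : TypeICornerCond R t1 t2 p1 p2 → weight R i (t1, p2) = 0 ∧ weight R i (t2, p1) = 0 ∧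
      (v = (t1, p1) ∨ v = (t2, p2)) := by
    refine fun hcond => ⟨weight_of_notMem i fun hw => ?_, weight_of_notMem i fun hw => ?_,
      hcond v hvR hvc⟩
    · simpa [ht, hp.symm] using hcond _ hw (mem_corners.2 (by simp))
    · simpa [ht.symm, hp] using hcond _ hw (mem_corners.2 (by simp))
  have hII : TypeIICornerCond R t1 t2 p1 p2 → weight R i (t1, p1) = 0 ∧
      weight R i (t2, p2) = 0 ∧ (v = (t1, p2) ∨ v = (t2, p1)) := by
    refine fun hcond => ⟨weight_of_notMem i fun hw => ?_, weight_of_notMem i fun hw => ?_,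
      hcond v hvR hvc⟩
    · simpa [ht, hp] using hcond _ hw (mem_corners.2 (by simp))
    · simpa [ht.symm, hp.symm] using hcond _ hw (mem_corners.2 (by simp))
  have hsgn : ∀ e : ℤ, (e = 1 ∧ S.sgn (t2, p0) = true ∨ e = -1 ∧ S.sgn (t2, p0) = false) →
      weight S i (t2, p0) = 0 ∨ weight S i (t2, p0) = e := by
    rintro e (⟨rfl, hs⟩ | ⟨rfl, hs⟩)
    · exact weight_of_sgn_true i hs
    · exact weight_of_sgn_false i hs
  have hsplit : (t.typeSign = -1 ∧ TypeICornerCond R t1 t2 p1 p2 ∨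
      t.typeSign = 1 ∧ TypeIICornerCond R t1 t2 p1 p2) ∧
      (t.orientSign = 1 ∧ S.sgn (t2, p0) = true ∨
        t.orientSign = -1 ∧ S.sgn (t2, p0) = false) := by
    cases t <;> simpa [OType.typeSign, OType.orientSign] using htype
  obtain ⟨hty, hor⟩ := hsplit
  have hcases : (m = 0 ∨ m = 1 ∨ m = -1) ∧
      size S i = size R i + 2 * m ^ 2 ∧
      writhe S i = writhe R i + 2 * t.typeSign * m ^ 2 ∧
      vertical S i = vertical R i + 2 * t.typeSign * t.orientSign * m ^ 2 ∧
      horizontal S i = horizontal R i - 2 * t.orientSign * m ^ 2 := by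
    have hs := hsgn _ hor
    have ho : t.orientSign = 1 ∨ t.orientSign = -1 := hor.imp And.left And.left
    obtain ⟨i1, i2, i3, i4⟩ := inv
    rw [i1, i2, i3, i4, ha, hb, hc, hd]
    rcases hty with ⟨hts, hcond⟩ | ⟨hts, hcond⟩
    · obtain ⟨zb, zc, rfl | rfl⟩ := hI hcond
      · have hp0' : p0 = p2 := hp0.resolve_left fun h' => hvS (h' ▸ hleft)
        subst hp0'
        have zd := hnot _ hright (mem_corners.2 (by simp))
        have za : weight R i (t1, p1) = -m := by linarith
        have hm : m = 0 ∨ m = t.orientSign := by simpa [hd, zd] using hs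
        rw [za, zb, zc, zd, hts]
        rcases hm with hm | hm <;> rcases ho with ho | ho <;> rw [hm, ho] <;>
          refine ⟨by norm_num, ?_, ?_, ?_, ?_⟩ <;> ring
      · have hp0' : p0 = p1 := hp0.resolve_right fun h' => hvS (h' ▸ hright)
        subst hp0'
        have za := hnot _ hleft (mem_corners.2 (by simp))
        have zd : weight R i (t2, p2) = -m := by linarith
        have hm : -m = 0 ∨ -m = t.orientSign := by simpa [hc, zc] using hs
        rw [za, zb, zc, zd, hts]
        have hm' : m = 0 ∨ m = -t.orientSign := by omega
        rcases hm' with hm | hm <;> rcases ho with ho | ho <;> rw [hm, ho] <;>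
          refine ⟨by norm_num, ?_, ?_, ?_, ?_⟩ <;> ring
    · obtain ⟨za, zd, rfl | rfl⟩ := hII hcond
      · have hp0' : p0 = p1 := hp0.resolve_right fun h' => hvS (h' ▸ hleft)
        subst hp0'
        have zc := hnot _ hright (mem_corners.2 (by simp))
        have zb : weight R i (t1, p2) = m := by linarith
        have hm : -m = 0 ∨ -m = t.orientSign := by simpa [hc, zc] using hs
        rw [za, zb, zc, zd, hts]
        have hm' : m = 0 ∨ m = -t.orientSign := by omega
        rcases hm' with hm | hm <;> rcases ho with ho | ho <;> rw [hm, ho] <;>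
          refine ⟨by norm_num, ?_, ?_, ?_, ?_⟩ <;> ring
      · have hp0' : p0 = p2 := hp0.resolve_left fun h' => hvS (h' ▸ hright)
        subst hp0'
        have zb := hnot _ hleft (mem_corners.2 (by simp))
        have zc : weight R i (t2, p1) = m := by linarith
        have hm : m = 0 ∨ m = t.orientSign := by simpa [hd, zd] using hs
        rw [za, zb, zc, zd, hts]
        rcases hm with hm | hm <;> rcases ho with ho | ho <;> rw [hm, ho] <;>
          refine ⟨by norm_num, ?_, ?_, ?_, ?_⟩ <;> ring
  obtain ⟨hm, i1, i2, i3, i4⟩ := hcases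
  unfold stabInvariant
  rw [i1, i2, i3, i4]
  by_cases hij : i = j
  · have hm1 : m ^ 2 = 1 := by
      have hm0 : m ≠ 0 := fun h' => hmod.1 h' hij
      rcases hm with h' | h' | h'
      · exact absurd h' hm0
      · rw [h']; rfl
      · rw [h']; rfl
    rw [hm1]
    cases t <;> cases t' <;> simp [OType.typeSign, OType.orientSign, hij] <;> ring
  · rw [hmod.2 hij]
    simp [hij]

/-- Along a chain of elementary moves, the invariant attached to `t` and `i` counts the
stabilizations of type `t` on the component `i` minus the destabilizations of this kind. -/
lemma LChain.stabInvariant_eq (t : OType) (i : ℕ) {R R' : RectDiagram}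
    {s : List (MoveKind × RectDiagram)} (hs : LChain R s R') :
    stabInvariant t R' i + 8 * (s.map Prod.fst).count (MoveKind.destab t i)
      = stabInvariant t R i + 8 * (s.map Prod.fst).count (MoveKind.stab t i) := by
  induction s generalizing R with
  | nil =>
    obtain rfl : R = R' := hs
    simp
  | cons x s ih =>
    obtain ⟨k, S⟩ := x
    obtain ⟨hk, hrest⟩ := hs
    have key := ih hrest
    simp only [List.map_cons, List.count_cons, Nat.cast_add, beq_iff_eq]
    cases k with
    | exchange =>
      rw [IsExchange.stabInvariant_eq hk t i] at key
      simpa using key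
    | stab t' j =>
      rw [IsStabOfOType.stabInvariant_eq hk.1 (Or.inl hk.2) t i] at key
      simp only [MoveKind.stab.injEq, reduceCtorEq, if_false, eq_comm (a := t'), eq_comm (a := j)]
      split_ifs at key ⊢ <;> push_cast <;> linarith
    | destab t' j =>
      have h' := IsStabOfOType.stabInvariant_eq hk.1 (Or.inr hk.2) t i
      simp only [MoveKind.destab.injEq, reduceCtorEq, if_false, eq_comm (a := t'),
        eq_comm (a := j)]
      split_ifs at h' ⊢ <;> push_cast <;> linarith

/-- If a chain of elementary moves starts and ends at the same diagram `R` and includes a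
stabilization of oriented type `t` on the component number `i`, then it also includes a
destabilization of oriented type `t` on the component number `i`. -/
theorem stab_forces_destab (R : RectDiagram) (s : List (MoveKind × RectDiagram))
    (hs : LChain R s R) (t : OType) (i : ℕ)
    (h : MoveKind.stab t i ∈ s.map Prod.fst) :
    MoveKind.destab t i ∈ s.map Prod.fst := by
  have h1 := hs.stabInvariant_eq t i
  have h2 := List.count_pos_iff.2 h
  exact List.count_pos_iff.1 (by omega)

end RectDiag
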